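/- arXiv:1301.1020 — 2 statements merged into one kernel-verified Lean document; each statement's English description precedes it below -/
import Mathlib

section
/- Let X be a topological space and let φ, ψ be two flows on X such that every point of X is non-wandering for both φ and ψ, and such that every z ∈ X satisfies z ∈ cl(int O⁺(z)) ∩ cl(int O⁻(z)). Then the orbit of every point is contained in the closure of its positive reachable set: O(z) ⊆ cl(O⁺(z)) for every z ∈ X. (The Poisson-stability step, Proposition 8.2 of Agrachev–Sachkov as used under the weaker hypothesis in the proof of Theorem 2.5 (ii) of the paper.) -/
open Set

/-- One step of the switched system: apply flow `φ` (if the boolean is `true`)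
or flow `ψ` (if it is `false`) for time `s`. -/
def flowStep {X : Type*} [TopologicalSpace X] (φ ψ : Flow ℝ X) (p : Bool × ℝ) (x : X) : X :=
  if p.1 then φ p.2 x else ψ p.2 x

/-- The point obtained from `x` by successively applying the steps in the list `L`. -/
def flowChain {X : Type*} [TopologicalSpace X] (φ ψ : Flow ℝ X) :
    List (Bool × ℝ) → X → X
  | [], x => x
  | p :: L, x => flowChain φ ψ L (flowStep φ ψ p x)

/-- Points reachable from `z` by a nonempty sequence of steps whose times all satisfy `P`. -/
def flowReach {X : Type*} [TopologicalSpace X] (φ ψ : Flow ℝ X) (P : ℝ → Prop) (z : X) :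
    Set X :=
  {y | ∃ L : List (Bool × ℝ), L ≠ [] ∧ (∀ p ∈ L, P p.2) ∧ y = flowChain φ ψ L z}

/-- The orbit of `z` under the group generated by the two flows. -/
def flowOrbit {X : Type*} [TopologicalSpace X] (φ ψ : Flow ℝ X) (z : X) : Set X :=
  flowReach φ ψ (fun _ => True) z

/-- The positive reachable set of `z`: all times are positive. -/
def flowReachPos {X : Type*} [TopologicalSpace X] (φ ψ : Flow ℝ X) (z : X) : Set X :=
  flowReach φ ψ (fun t => 0 < t) z

/-- The negative reachable set of `z`: all times are negative. -/
def flowReachNeg {X : Type*} [TopologicalSpace X] (φ ψ : Flow ℝ X) (z : X) : Set X :=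
  flowReach φ ψ (fun t => t < 0) z

/-- A point `z` is non-wandering for the flow `φ` if every neighborhood of `z` returns to
itself at arbitrarily large times. -/
def IsNonWandering {X : Type*} [TopologicalSpace X] (φ : Flow ℝ X) (z : X) : Prop :=
  ∀ U ∈ nhds z, ∀ t > (0 : ℝ), ∃ tt > t, ((fun x => φ tt x) '' U ∩ U).Nonempty

/-- If all points are non-wandering for `θ` and `S` is stable under the positive-time maps of `θ`,
then the negative-time maps of `θ` send the closure of the interior of `S` into the closure
of `S`. -/
theorem IsNonWandering.map_neg_mem_closure {X : Type*} [TopologicalSpace X] {θ : Flow ℝ X}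
    (hθ : ∀ z : X, IsNonWandering θ z) {S : Set X} (hS : ∀ t > 0, MapsTo (θ t) S S) {w : X}
    (hw : w ∈ closure (interior S)) {t : ℝ} (ht : 0 < t) : θ (-t) w ∈ closure S := by
  refine mem_closure_iff.2 fun V hV hwV => ?_
  have hV' : IsOpen (θ (-t) ⁻¹' V) := hV.preimage (by fun_prop)
  obtain ⟨u, huV, huS⟩ := mem_closure_iff.1 hw _ hV' hwV
  obtain ⟨T, hT, _, ⟨x, hx, rfl⟩, hTx⟩ :=
    hθ u _ ((hV'.inter isOpen_interior).mem_nhds ⟨huV, huS⟩) t ht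
  refine ⟨θ (-t + T) x, ?_, hS _ (by linarith) (interior_subset hx.2)⟩
  rw [θ.map_add]
  exact hTx.1

theorem continuous_flowStep {X : Type*} [TopologicalSpace X] (φ ψ : Flow ℝ X) (p : Bool × ℝ) :
    Continuous (flowStep φ ψ p) := by
  obtain ⟨_ | _, s⟩ := p
  · exact ψ.continuous continuous_const continuous_id
  · exact φ.continuous continuous_const continuous_id

theorem flowChain_append {X : Type*} [TopologicalSpace X] (φ ψ : Flow ℝ X)
    (L M : List (Bool × ℝ)) (x : X) :
    flowChain φ ψ (L ++ M) x = flowChain φ ψ M (flowChain φ ψ L x) := by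
  induction L generalizing x with
  | nil => rfl
  | cons p L ih => exact ih _

/-- A set stable under all steps whose times satisfy `P` contains the points reachable from its
points by such steps. -/
theorem flowReach_subset {X : Type*} [TopologicalSpace X] {φ ψ : Flow ℝ X} {P : ℝ → Prop}
    {C : Set X} (hC : ∀ p : Bool × ℝ, P p.2 → MapsTo (flowStep φ ψ p) C C) {z : X} (hz : z ∈ C) :
    flowReach φ ψ P z ⊆ C := by
  rintro _ ⟨L, -, hL, rfl⟩
  induction L generalizing z with
  | nil => exact hz
  | cons p L ih =>
    exact ih (hC p (hL p List.mem_cons_self) hz) fun q hq => hL q (List.mem_cons_of_mem _ hq)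

theorem mapsTo_flowStep_flowReach {X : Type*} [TopologicalSpace X] (φ ψ : Flow ℝ X)
    {P : ℝ → Prop} (z : X) {p : Bool × ℝ} (hp : P p.2) :
    MapsTo (flowStep φ ψ p) (flowReach φ ψ P z) (flowReach φ ψ P z) := by
  rintro _ ⟨L, -, hL, rfl⟩
  refine ⟨L ++ [p], by simp, fun q hq => ?_, by rw [flowChain_append]; rfl⟩
  rcases List.mem_append.1 hq with hq | hq
  · exact hL q hq
  · rwa [List.mem_singleton.1 hq]

/-- The Poisson-stability step: if every point is non-wandering for both flows and lies in
the closure of the interior of both its positive and negative reachable sets, then the orbit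
of every point is contained in the closure of its positive reachable set. -/
theorem orbit_subset_closure_reachPos
    {X : Type*} [TopologicalSpace X] (φ ψ : Flow ℝ X)
    (hφ : ∀ z : X, IsNonWandering φ z) (hψ : ∀ z : X, IsNonWandering ψ z)
    (h : ∀ z : X, z ∈ closure (interior (flowReachPos φ ψ z)) ∩
      closure (interior (flowReachNeg φ ψ z))) :
    ∀ z : X, flowOrbit φ ψ z ⊆ closure (flowReachPos φ ψ z) := by
  intro z
  have hpos : ∀ p : Bool × ℝ, 0 < p.2 → MapsTo (flowStep φ ψ p)
      (closure (flowReachPos φ ψ z)) (closure (flowReachPos φ ψ z)) := fun p hp =>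
    (mapsTo_flowStep_flowReach φ ψ (P := fun t => 0 < t) z hp).closure (continuous_flowStep φ ψ p)
  have hint : ∀ y ∈ closure (flowReachPos φ ψ z),
      y ∈ closure (interior (closure (flowReachPos φ ψ z))) := fun y hy =>
    closure_mono (interior_mono (flowReach_subset hpos hy)) (h y).1
  refine flowReach_subset ?_ (closure_mono interior_subset (h z).1)
  rintro ⟨b, s⟩ - y hy
  rcases lt_trichotomy s 0 with hs | rfl | hs
  · rw [← closure_closure, ← neg_neg s]
    cases b
    · exact IsNonWandering.map_neg_mem_closure hψ (fun t ht => hpos (false, t) ht) (hint y hy)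
        (neg_pos.2 hs)
    · exact IsNonWandering.map_neg_mem_closure hφ (fun t ht => hpos (true, t) ht) (hint y hy)
        (neg_pos.2 hs)
  · cases b <;> simpa [flowStep] using hy
  · exact hpos _ hs hy
end

section
/- (Krener's theorem, time-oriented case, on ℝⁿ.) Let n ≥ 1, k ≥ 1, and let X₁, X₂ : ℝⁿ → ℝⁿ be vector fields of class C^k admitting global flows φ₁, φ₂. If z ∈ ℝⁿ satisfies Lie^{k−1}(X₁, X₂)(z) = ℝⁿ, then z lies in the closure of the interior of its positive reachable set and in the closure of the interior of its negative reachable set: z ∈ cl(int O⁺(z)) ∩ cl(int O⁻(z)). (Theorem 2.3 (ii) of the paper, stated in ℝⁿ with complete vector fields.) -/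
open Set

/-- Iterated Lie brackets of the two vector fields `X₁, X₂`: level `0` consists of
`X₁` and `X₂` themselves, and level `m+1` consists of brackets `[Xᵢ, V]` with `V` of
level `m`. -/
def iterBrackets {E : Type*} [NormedAddCommGroup E] [NormedSpace ℝ E]
    (X₁ X₂ : E → E) : ℕ → Set (E → E)
  | 0 => {X₁, X₂}
  | m + 1 => {W | ∃ V ∈ iterBrackets X₁ X₂ m,
      W = VectorField.lieBracket ℝ X₁ V ∨ W = VectorField.lieBracket ℝ X₂ V}

/-- The point obtained from `x` by successively applying the (global) flows `φ₁, φ₂`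
with the switching pattern and times recorded in the list `L`. -/
def mapChain {E : Type*} (φ₁ φ₂ : ℝ → E → E) : List (Bool × ℝ) → E → E
  | [], x => x
  | p :: L, x => mapChain φ₁ φ₂ L (if p.1 then φ₁ p.2 x else φ₂ p.2 x)

/-- Points reachable from `z` by a nonempty sequence of steps of the two flows, all of
whose times satisfy the predicate `P`. -/
def mapReach {E : Type*} (φ₁ φ₂ : ℝ → E → E) (P : ℝ → Prop) (z : E) : Set E :=
  {y | ∃ L : List (Bool × ℝ), L ≠ [] ∧ (∀ p ∈ L, P p.2) ∧ y = mapChain φ₁ φ₂ L z}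

section

open Filter Topology Metric

section Flow

variable {E : Type*} [NormedAddCommGroup E] [NormedSpace ℝ E]

/-- `φ` is a global flow of the vector field `X`. -/
structure IsGlobalFlow (X : E → E) (φ : ℝ → E → E) : Prop where
  map_zero : ∀ x, φ 0 x = x
  hasDerivAt : ∀ t x, HasDerivAt (fun s => φ s x) (X (φ t x)) t

variable {X : E → E} {φ : ℝ → E → E}

theorem IsGlobalFlow.continuous_time (h : IsGlobalFlow X φ) (x : E) :
    Continuous fun s => φ s x :=
  continuous_iff_continuousAt.2 fun t => (h.hasDerivAt t x).continuousAt

theorem IsGlobalFlow.mem_closedBall (h : IsGlobalFlow X φ) {x₀ : E} {M : ℝ} (hM0 : 0 ≤ M)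
    (hM : ∀ x ∈ closedBall x₀ 1, ‖X x‖ ≤ M) {x : E} (hx : x ∈ closedBall x₀ (1 / 2))
    {t : ℝ} (ht : t ∈ Icc 0 (1 / (2 * (M + 1)))) : φ t x ∈ closedBall x₀ 1 := by
  have hle : ∀ s ∈ Icc 0 (1 / (2 * (M + 1))), 1 / 2 + (M + 1) * s ≤ 1 := by
    intro s hs
    have := mul_le_mul_of_nonneg_left hs.2 (by positivity : 0 ≤ M + 1)
    have h2 : (M + 1) * (1 / (2 * (M + 1))) = 1 / 2 := by field_simp
    linarith
  have key := image_norm_le_of_norm_deriv_right_lt_deriv_boundary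
    (f := fun s => φ s x - x₀) (f' := fun s => X (φ s x)) (a := 0) (b := 1 / (2 * (M + 1)))
    (B := fun s => 1 / 2 + (M + 1) * s) (B' := fun _ => M + 1)
    ((h.continuous_time x).sub continuous_const).continuousOn
    (fun s _ => ((h.hasDerivAt s x).sub_const x₀).hasDerivWithinAt)
    (by simpa [h.map_zero, dist_eq_norm] using hx)
    (fun s => by simpa using ((hasDerivAt_id s).const_mul (M + 1)).const_add (1 / 2))
    (by
      intro s hs heq
      have : ‖X (φ s x)‖ ≤ M := hM _ (by
        rw [Metric.mem_closedBall, dist_eq_norm, heq]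
        exact hle s ⟨hs.1, hs.2.le⟩)
      linarith)
  rw [Metric.mem_closedBall, dist_eq_norm]
  exact (key ht).trans (hle t ht)

/-- The flow of a `C¹` vector field is locally Lipschitz in the initial condition, and the field
has a bounded derivative along it. -/
theorem IsGlobalFlow.exists_local_bounds [FiniteDimensional ℝ E] (h : IsGlobalFlow X φ)
    (hX : ContDiff ℝ 1 X) (x₀ : E) :
    ∃ ε > 0, ∃ C : ℝ, 1 ≤ C ∧
      (∀ x ∈ closedBall x₀ 1, ‖fderiv ℝ X x‖ ≤ C) ∧
      (∀ t ∈ Icc 0 ε, ∀ x ∈ closedBall x₀ (1 / 2), φ t x ∈ closedBall x₀ 1) ∧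
      (∀ t ∈ Icc 0 ε, ∀ x ∈ closedBall x₀ (1 / 2), ∀ y ∈ closedBall x₀ (1 / 2),
        ‖φ t x - φ t y‖ ≤ C * ‖x - y‖) := by
  have hcpt : IsCompact (closedBall x₀ (1 : ℝ)) := by
    have := FiniteDimensional.proper_real E
    exact isCompact_closedBall _ _
  obtain ⟨M, hM⟩ := hcpt.exists_bound_of_continuousOn hX.continuous.continuousOn
  obtain ⟨K, hK⟩ := hcpt.exists_bound_of_continuousOn
    (hX.continuous_fderiv one_ne_zero).continuousOn
  have hM0 : 0 ≤ M := (norm_nonneg _).trans (hM x₀ (mem_closedBall_self zero_le_one))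
  have hK0 : 0 ≤ K := (norm_nonneg _).trans (hK x₀ (mem_closedBall_self zero_le_one))
  have hlip : LipschitzOnWith ⟨K, hK0⟩ X (closedBall x₀ 1) :=
    (convex_closedBall _ _).lipschitzOnWith_of_nnnorm_fderiv_le
      (fun x _ => (hX.differentiable one_ne_zero) x) (fun x hx => hK x hx)
  set ε := 1 / (2 * (M + 1)) with hε
  have hmem : ∀ t ∈ Icc 0 ε, ∀ x ∈ closedBall x₀ (1 / 2), φ t x ∈ closedBall x₀ 1 :=
    fun t ht x hx => h.mem_closedBall hM0 hM hx ht
  refine ⟨ε, by positivity, max (max 1 K) (Real.exp (K * ε)),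
    (le_max_left _ _).trans (le_max_left _ _),
    fun x hx => (hK x hx).trans ((le_max_right _ _).trans (le_max_left _ _)), hmem, ?_⟩
  intro t ht x hx y hy
  have := dist_le_of_trajectories_ODE_of_mem (v := fun _ => X) (s := fun _ => closedBall x₀ 1)
    (K := ⟨K, hK0⟩) (a := 0) (b := ε) (f := fun s => φ s x) (g := fun s => φ s y)
    (fun _ _ => hlip) (h.continuous_time x).continuousOn
    (fun s _ => (h.hasDerivAt s x).hasDerivWithinAt) (fun s hs => hmem s ⟨hs.1, hs.2.le⟩ x hx)
    (h.continuous_time y).continuousOn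
    (fun s _ => (h.hasDerivAt s y).hasDerivWithinAt) (fun s hs => hmem s ⟨hs.1, hs.2.le⟩ y hy)
    le_rfl t ht
  simp only [h.map_zero, dist_eq_norm, sub_zero] at this
  rw [mul_comm]
  refine this.trans ?_
  gcongr
  refine le_max_of_le_right (Real.exp_le_exp.2 ?_)
  exact mul_le_mul_of_nonneg_left ht.2 hK0

/-- Short-time existence for a linear equation with continuous bounded coefficients. -/
theorem exists_linear_ode_solution [CompleteSpace E] {B : ℝ → E →L[ℝ] E} (hB : Continuous B)
    {ε C : ℝ} (hε : 0 < ε) (hC : 1 ≤ C) (hBC : ∀ t ∈ Icc 0 ε, ‖B t‖ ≤ C) :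
    ∃ δ > 0, δ ≤ ε ∧ ∃ A : ℝ → E →L[ℝ] E, A 0 = ContinuousLinearMap.id ℝ E ∧
      ∀ t ∈ Icc 0 δ, HasDerivWithinAt A (B t ∘L A t) (Icc 0 δ) t := by
  have hC0 : 0 ≤ C := zero_le_one.trans hC
  set δ := min ε (1 / (2 * C)) with hδ
  have hδ0 : 0 < δ := lt_min hε (by positivity)
  have hδC : 2 * C * δ ≤ 1 := by
    have := mul_le_mul_of_nonneg_left (min_le_right ε (1 / (2 * C))) (by positivity : 0 ≤ 2 * C)
    have h2 : 2 * C * (1 / (2 * C)) = 1 := by field_simp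
    linarith
  have hsub : ∀ t ∈ Icc 0 δ, ‖B t‖ ≤ C := fun t ht =>
    hBC t ⟨ht.1, ht.2.trans (min_le_left _ _)⟩
  have hPL : IsPicardLindelof (fun t (A : E →L[ℝ] E) => B t ∘L A)
      (⟨0, left_mem_Icc.2 hδ0.le⟩ : Icc 0 δ) (ContinuousLinearMap.id ℝ E) 1 0
      ⟨2 * C, by positivity⟩ ⟨C, hC0⟩ := by
    constructor
    · intro t ht
      refine LipschitzOnWith.of_dist_le_mul fun A _ A' _ => ?_
      rw [dist_eq_norm, dist_eq_norm, ← ContinuousLinearMap.comp_sub]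
      exact (ContinuousLinearMap.opNorm_comp_le _ _).trans
        (mul_le_mul_of_nonneg_right (hsub t ht) (norm_nonneg _))
    · intro A _
      exact (hB.clm_comp continuous_const).continuousOn
    · intro t ht A hA
      have h1 : ‖A‖ ≤ 2 := by
        have h2 : ‖A - ContinuousLinearMap.id ℝ E‖ ≤ 1 := by
          simpa [dist_eq_norm] using hA
        have h3 := norm_le_norm_add_norm_sub' A (ContinuousLinearMap.id ℝ E)
        have h4 : ‖ContinuousLinearMap.id ℝ E‖ ≤ 1 := ContinuousLinearMap.norm_id_le
        linarith
      refine (ContinuousLinearMap.opNorm_comp_le _ _).trans ?_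
      have := mul_le_mul (hsub t ht) h1 (norm_nonneg _) hC0
      rw [mul_comm C] at this
      exact this
    · change 2 * C * max (δ - 0) (0 - 0) ≤ 1 - 0
      simpa [hδ0.le] using hδC
  obtain ⟨A, hA0, hA⟩ := hPL.exists_eq_forall_mem_Icc_hasDerivWithinAt₀
  exact ⟨δ, hδ0, min_le_left _ _, A, hA0, hA⟩

/-- The solution of the variational equation linearizes the flow, uniformly in time. -/
theorem IsGlobalFlow.exists_linearization_bound [FiniteDimensional ℝ E] (h : IsGlobalFlow X φ)
    (hX : ContDiff ℝ 1 X) {x₀ : E} {δ C : ℝ} (hC : 1 ≤ C)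
    (hfd : ∀ x ∈ closedBall x₀ 1, ‖fderiv ℝ X x‖ ≤ C)
    (hmem : ∀ t ∈ Icc 0 δ, ∀ x ∈ closedBall x₀ (1 / 2), φ t x ∈ closedBall x₀ 1)
    (hlip : ∀ t ∈ Icc 0 δ, ∀ x ∈ closedBall x₀ (1 / 2), ∀ y ∈ closedBall x₀ (1 / 2),
      ‖φ t x - φ t y‖ ≤ C * ‖x - y‖)
    {A : ℝ → E →L[ℝ] E} (hA0 : A 0 = ContinuousLinearMap.id ℝ E)
    (hA : ∀ t ∈ Icc 0 δ, HasDerivWithinAt A (fderiv ℝ X (φ t x₀) ∘L A t) (Icc 0 δ) t)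
    {η : ℝ} (hη : 0 < η) :
    ∃ ρ > 0, ∀ x ∈ ball x₀ ρ, ∀ y ∈ ball x₀ ρ, ∀ t ∈ Icc 0 δ,
      ‖φ t x - φ t y - A t (x - y)‖ ≤ η * ‖x - y‖ := by
  have hC0 : 0 < C := zero_lt_one.trans_le hC
  have hcpt : IsCompact (closedBall x₀ (1 : ℝ)) := by
    have := FiniteDimensional.proper_real E
    exact isCompact_closedBall _ _
  have huc := hcpt.uniformContinuousOn_of_continuous
    (hX.continuous_fderiv one_ne_zero).continuousOn
  set η' := η / Real.exp (C * δ) with hη'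
  have hη'0 : 0 < η' := by positivity
  obtain ⟨r, hr, hr'⟩ := Metric.uniformContinuousOn_iff_le.1 huc η' hη'0
  refine ⟨min (1 / 2) (r / C), by positivity, fun x hx y hy t ht => ?_⟩
  have hball : ∀ w ∈ ball x₀ (min (1 / 2) (r / C)), w ∈ closedBall x₀ (1 / 2) ∧
      ∀ s ∈ Icc 0 δ, φ s w ∈ closedBall x₀ 1 ∩ closedBall (φ s x₀) r := by
    intro w hw
    have hw1 : w ∈ closedBall x₀ (1 / 2) :=
      ball_subset_closedBall (ball_subset_ball (min_le_left _ _) hw)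
    refine ⟨hw1, fun s hs => ⟨hmem s hs w hw1, ?_⟩⟩
    rw [Metric.mem_closedBall, dist_eq_norm]
    refine (hlip s hs w hw1 x₀ (mem_closedBall_self (by norm_num))).trans ?_
    have h1 : ‖w - x₀‖ ≤ r / C := by
      rw [← dist_eq_norm]
      exact (lt_of_lt_of_le hw (min_le_right _ _)).le
    calc C * ‖w - x₀‖ ≤ C * (r / C) := by gcongr
      _ = r := by field_simp
  have hB : ∀ s ∈ Icc 0 δ, ‖X (φ s x) - X (φ s y) - fderiv ℝ X (φ s x₀) (φ s x - φ s y)‖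
      ≤ η' * (C * ‖x - y‖) := by
    intro s hs
    refine (((convex_closedBall x₀ 1).inter
      (convex_closedBall (φ s x₀) r)).norm_image_sub_le_of_norm_fderiv_le' (C := η')
      (fun w _ => (hX.differentiable one_ne_zero) w) (fun w hw => ?_)
      ((hball y hy).2 s hs) ((hball x hx).2 s hs)).trans ?_
    · rw [← dist_eq_norm]
      exact hr' w hw.1 _ (hmem s hs x₀ (mem_closedBall_self (by norm_num))) hw.2
    · gcongr
      exact hlip s hs x (hball x hx).1 y (hball y hy).1
  have hder : ∀ s ∈ Icc 0 δ, HasDerivWithinAt (fun s => φ s x - φ s y - A s (x - y))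
      (X (φ s x) - X (φ s y) - fderiv ℝ X (φ s x₀) (A s (x - y))) (Icc 0 δ) s := by
    intro s hs
    have h1 := (hA s hs).clm_apply (hasDerivWithinAt_const s (Icc 0 δ) (x - y))
    have h2 := (((h.hasDerivAt s x).sub (h.hasDerivAt s y)).hasDerivWithinAt
      (s := Icc 0 δ)).sub h1
    refine h2.congr_deriv ?_
    rw [(A s).map_zero, add_zero, ContinuousLinearMap.comp_apply]
  have hgr := norm_le_gronwallBound_of_norm_deriv_right_le (a := 0) (b := δ) (δ := 0) (K := C)
    (ε := η' * (C * ‖x - y‖)) (f := fun s => φ s x - φ s y - A s (x - y))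
    (fun s hs => (hder s hs).continuousWithinAt)
    (fun s hs => (hder s ⟨hs.1, hs.2.le⟩).mono_of_mem_nhdsWithin
      (Icc_mem_nhdsGE_of_mem hs))
    (by simp [hA0, h.map_zero])
    (by
      intro s hs
      have hs' : s ∈ Icc 0 δ := ⟨hs.1, hs.2.le⟩
      have e1 : X (φ s x) - X (φ s y) - fderiv ℝ X (φ s x₀) (A s (x - y)) =
          fderiv ℝ X (φ s x₀) (φ s x - φ s y - A s (x - y)) +
          (X (φ s x) - X (φ s y) - fderiv ℝ X (φ s x₀) (φ s x - φ s y)) := by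
        rw [map_sub _ (φ s x - φ s y)]
        abel
      rw [e1]
      refine (norm_add_le _ _).trans (add_le_add ?_ (hB s hs'))
      exact ((fderiv ℝ X (φ s x₀)).le_opNorm _).trans (mul_le_mul_of_nonneg_right
        (hfd _ (hmem s hs' x₀ (mem_closedBall_self (by norm_num)))) (norm_nonneg _))) t ht
  refine hgr.trans ?_
  rw [gronwallBound_of_K_ne_0 hC0.ne']
  have hexp : Real.exp (C * (t - 0)) ≤ Real.exp (C * δ) := by
    rw [sub_zero]
    exact Real.exp_le_exp.2 (mul_le_mul_of_nonneg_left ht.2 hC0.le)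
  calc 0 * Real.exp (C * (t - 0)) + η' * (C * ‖x - y‖) / C * (Real.exp (C * (t - 0)) - 1)
      = η' * ‖x - y‖ * (Real.exp (C * (t - 0)) - 1) := by field_simp; ring
    _ ≤ η' * ‖x - y‖ * Real.exp (C * δ) := by gcongr; linarith
    _ = η * ‖x - y‖ := by rw [hη']; field_simp

/-- The flow of a `C¹` vector field is strictly differentiable for short positive times, and its
spatial derivative solves the variational equation at time zero. -/
theorem IsGlobalFlow.exists_hasStrictFDerivAt [FiniteDimensional ℝ E] (h : IsGlobalFlow X φ)
    (hX : ContDiff ℝ 1 X) (x₀ : E) :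
    ∃ A : ℝ → E →L[ℝ] E, A 0 = ContinuousLinearMap.id ℝ E ∧
      HasDerivWithinAt A (fderiv ℝ X x₀) (Ioi 0) 0 ∧
      ∀ᶠ t in 𝓝[>] 0, HasStrictFDerivAt (fun p : ℝ × E => φ p.1 p.2)
        (A t ∘L ContinuousLinearMap.snd ℝ ℝ E +
          (ContinuousLinearMap.fst ℝ ℝ E).smulRight (X (φ t x₀))) (t, x₀) := by
  have := FiniteDimensional.complete ℝ E
  obtain ⟨ε, hε, C, hC, hfd, hmem, hlip⟩ := h.exists_local_bounds hX x₀
  have hC0 : 0 < C := zero_lt_one.trans_le hC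
  have hself : x₀ ∈ closedBall x₀ (1 / 2 : ℝ) := mem_closedBall_self (by norm_num)
  obtain ⟨δ, hδ, hδε, A, hA0, hA⟩ := exists_linear_ode_solution
    (B := fun t => fderiv ℝ X (φ t x₀))
    ((hX.continuous_fderiv one_ne_zero).comp (h.continuous_time x₀)) hε hC
    (fun t ht => hfd _ (hmem t ht x₀ hself))
  have hsub : ∀ t ∈ Icc 0 δ, t ∈ Icc 0 ε := fun t ht => ⟨ht.1, ht.2.trans hδε⟩
  refine ⟨A, hA0, ?_, ?_⟩
  · have : HasDerivWithinAt A (fderiv ℝ X (φ 0 x₀) ∘L A 0) (Ioi 0) 0 :=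
      (hA 0 (left_mem_Icc.2 hδ.le)).mono_of_mem_nhdsWithin
        (mem_of_superset (Ioo_mem_nhdsGT hδ) Ioo_subset_Icc_self)
    rwa [hA0, h.map_zero, ContinuousLinearMap.comp_id] at this
  filter_upwards [Ioo_mem_nhdsGT hδ] with t ht
  have htI : Icc 0 δ ∈ 𝓝 t := Icc_mem_nhds ht.1 ht.2
  have hcontφ : ContinuousAt (fun p : ℝ × E => φ p.1 p.2) (t, x₀) := by
    rw [ContinuousAt, tendsto_iff_norm_sub_tendsto_zero]
    have hlim : Tendsto (fun p : ℝ × E => C * ‖p.2 - x₀‖ + ‖φ p.1 x₀ - φ t x₀‖)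
        (𝓝 (t, x₀)) (𝓝 0) := by
      have : Continuous (fun p : ℝ × E => C * ‖p.2 - x₀‖ + ‖φ p.1 x₀ - φ t x₀‖) := by
        have := (h.continuous_time x₀).comp (continuous_fst (X := ℝ) (Y := E))
        exact (continuous_const.mul (continuous_snd.sub continuous_const).norm).add
          (this.sub continuous_const).norm
      simpa using this.tendsto (t, x₀)
    refine squeeze_zero' (Eventually.of_forall fun _ => norm_nonneg _) ?_ hlim
    filter_upwards [prod_mem_nhds htI (closedBall_mem_nhds x₀ (by norm_num : (0 : ℝ) < 1 / 2))]
      with p hp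
    exact (norm_sub_le_norm_sub_add_norm_sub _ (φ p.1 x₀) _).trans
      (add_le_add_left (hlip p.1 (hsub _ hp.1) _ hp.2 _ hself) _)
  have hAcont : ContinuousAt A t :=
    ((hA t ⟨ht.1.le, ht.2.le⟩).hasDerivAt htI).continuousAt
  refine HasStrictFDerivAt.of_isLittleO (Asymptotics.isLittleO_iff.2 fun c hc => ?_)
  have hc3 : 0 < c / 3 := by positivity
  obtain ⟨ρ, hρ, hlin⟩ := h.exists_linearization_bound hX hC hfd
    (fun t ht => hmem t (hsub t ht)) (fun t ht => hlip t (hsub t ht)) hA0 hA hc3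
  have hXφ : ∀ᶠ p : ℝ × E in 𝓝 (t, x₀), ‖X (φ p.1 p.2) - X (φ t x₀)‖ < c / 3 := by
    have := (hX.continuous.continuousAt (x := φ t x₀)).comp_of_eq hcontφ rfl
    simpa [dist_eq_norm] using Metric.tendsto_nhds.1 this (c / 3) hc3
  have hAev : ∀ᶠ s in 𝓝 t, ‖A s - A t‖ < c / 3 := by
    simpa [dist_eq_norm] using Metric.tendsto_nhds.1 hAcont (c / 3) hc3
  obtain ⟨r₁, hr₁, hball₁⟩ := Metric.mem_nhds_iff.1 (inter_mem hAev htI)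
  obtain ⟨r₂, hr₂, hball₂⟩ := Metric.mem_nhds_iff.1 hXφ
  have hN : ball (t, x₀) (min (min r₁ r₂) ρ) ∈ 𝓝 (t, x₀) := ball_mem_nhds _ (by positivity)
  filter_upwards [prod_mem_nhds hN hN] with p hp
  obtain ⟨⟨s', y'⟩, ⟨s, y⟩⟩ := p
  rw [← ball_prod_same] at hp
  obtain ⟨⟨hs', hy'⟩, ⟨hs, hy⟩⟩ := hp
  dsimp only at hs' hy' hs hy ⊢
  have hsA := hball₁ (ball_subset_ball ((min_le_left _ _).trans (min_le_left _ _)) hs)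
  have e1 : ‖φ s y' - φ s y - A s (y' - y)‖ ≤ c / 3 * ‖y' - y‖ :=
    hlin y' (ball_subset_ball (min_le_right _ _) hy') y
      (ball_subset_ball (min_le_right _ _) hy) s hsA.2
  have e2 : ‖(A s - A t) (y' - y)‖ ≤ c / 3 * ‖y' - y‖ :=
    ((A s - A t).le_opNorm _).trans (mul_le_mul_of_nonneg_right hsA.1.le (norm_nonneg _))
  have e3 : ‖φ s' y' - φ s y' - (s' - s) • X (φ t x₀)‖ ≤ c / 3 * ‖s' - s‖ := by
    have := (convex_ball t (min (min r₁ r₂) ρ)).norm_image_sub_le_of_norm_hasDerivWithin_le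
      (f := fun τ => φ τ y' - τ • X (φ t x₀)) (f' := fun τ => X (φ τ y') - X (φ t x₀))
      (C := c / 3) (fun τ _ =>
        (((h.hasDerivAt τ y').sub ((hasDerivAt_id τ).smul_const
          (X (φ t x₀)))).congr_deriv (by rw [one_smul])).hasDerivWithinAt)
      (fun τ hτ => by
        have : (τ, y') ∈ ball (t, x₀) r₂ := by
          rw [← ball_prod_same]
          exact ⟨ball_subset_ball ((min_le_left _ _).trans (min_le_right _ _)) hτ,
            ball_subset_ball ((min_le_left _ _).trans (min_le_right _ _)) hy'⟩
        exact (hball₂ this).le) hs hs'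
    convert this using 2
    rw [sub_smul]
    abel
  have hs_le : ‖s' - s‖ ≤ ‖((s', y') : ℝ × E) - (s, y)‖ :=
    norm_fst_le (((s', y') : ℝ × E) - (s, y))
  have hy_le : ‖y' - y‖ ≤ ‖((s', y') : ℝ × E) - (s, y)‖ :=
    norm_snd_le (((s', y') : ℝ × E) - (s, y))
  have hdec : φ s' y' - φ s y - (A t ∘L ContinuousLinearMap.snd ℝ ℝ E +
      (ContinuousLinearMap.fst ℝ ℝ E).smulRight (X (φ t x₀))) ((s', y') - (s, y)) =
      (φ s' y' - φ s y' - (s' - s) • X (φ t x₀)) + (φ s y' - φ s y - A s (y' - y)) +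
        (A s - A t) (y' - y) := by
    simp only [add_apply, ContinuousLinearMap.comp_apply,
      ContinuousLinearMap.smulRight_apply, ContinuousLinearMap.coe_fst',
      ContinuousLinearMap.coe_snd', Prod.mk_sub_mk, sub_apply]
    abel
  rw [hdec]
  refine (norm_add₃_le).trans ?_
  nlinarith

end Flow

section Reach

variable {E : Type*} [NormedAddCommGroup E] [NormedSpace ℝ E]

theorem mapChain_append {α : Type*} (φ₁ φ₂ : ℝ → α → α) (L L' : List (Bool × ℝ)) (x : α) :
    mapChain φ₁ φ₂ (L ++ L') x = mapChain φ₁ φ₂ L' (mapChain φ₁ φ₂ L x) := by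
  induction L generalizing x with
  | nil => rfl
  | cons p L ih => simp [mapChain, ih]

theorem mapReach_append {α : Type*} {φ₁ φ₂ : ℝ → α → α} {P : ℝ → Prop} {x y : α}
    (hy : y ∈ mapReach φ₁ φ₂ P x) (b : Bool) {t : ℝ} (ht : P t) :
    (if b then φ₁ t y else φ₂ t y) ∈ mapReach φ₁ φ₂ P x := by
  obtain ⟨L, -, hL, rfl⟩ := hy
  refine ⟨L ++ [(b, t)], by simp, fun p hp => ?_, by simp [mapChain_append, mapChain]⟩
  rcases List.mem_append.1 hp with hp | hp
  · exact hL p hp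
  · rw [List.mem_singleton.1 hp]
    exact ht

theorem contDiff_of_mem_iterBrackets {X₁ X₂ : E → E} {k : ℕ} (hX₁ : ContDiff ℝ k X₁)
    (hX₂ : ContDiff ℝ k X₂) {m j : ℕ} (hm : m + j ≤ k) {V : E → E}
    (hV : V ∈ iterBrackets X₁ X₂ m) : ContDiff ℝ j V := by
  induction m generalizing j V with
  | zero =>
    have hj : (j : WithTop ℕ∞) ≤ k := by exact_mod_cast (by omega : j ≤ k)
    rcases hV with rfl | rfl
    exacts [hX₁.of_le hj, hX₂.of_le hj]
  | succ m ih =>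
    obtain ⟨W, hW, h⟩ := hV
    have hW' : ContDiff ℝ (j + 1 : ℕ) W := ih (by omega) hW
    have hj : ((j + 1 : ℕ) : WithTop ℕ∞) ≤ k := by exact_mod_cast (by omega : j + 1 ≤ k)
    rcases h with rfl | rfl
    exacts [(hX₁.of_le hj).lieBracket_vectorField hW' (by simp),
      (hX₂.of_le hj).lieBracket_vectorField hW' (by simp)]

theorem IsGlobalFlow.neg {X : E → E} {φ : ℝ → E → E} (h : IsGlobalFlow X φ) :
    IsGlobalFlow (fun x => -X x) (fun t => φ (-t)) where
  map_zero x := by simpa using h.map_zero x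
  hasDerivAt t x := by
    simpa [Function.comp_def] using (h.hasDerivAt (-t) x).scomp t (hasDerivAt_neg t)

/-- Reversing both fields changes their iterated brackets only by a sign. -/
theorem exists_mem_iterBrackets_neg {X₁ X₂ : E → E} {m : ℕ} {V : E → E}
    (hV : V ∈ iterBrackets X₁ X₂ m) :
    ∃ V' ∈ iterBrackets (fun x => -X₁ x) (fun x => -X₂ x) m, V' = V ∨ V' = fun x => -V x := by
  induction m generalizing V with
  | zero =>
    rcases hV with rfl | rfl
    exacts [⟨_, Or.inl rfl, Or.inr rfl⟩, ⟨_, Or.inr rfl, Or.inr rfl⟩]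
  | succ m ih =>
    have key : ∀ X W : E → E, VectorField.lieBracket ℝ (fun x => -X x) W =
        fun x => -VectorField.lieBracket ℝ X W x := by
      intro X W
      ext x
      simp [VectorField.lieBracket, fderiv_fun_neg]
      abel
    have key' : ∀ X W : E → E, VectorField.lieBracket ℝ (fun x => -X x) (fun x => -W x) =
        VectorField.lieBracket ℝ X W := by
      intro X W
      ext x
      simp [VectorField.lieBracket, fderiv_fun_neg]
    obtain ⟨W, hW, h⟩ := hV
    obtain ⟨W', hW', h'⟩ := ih hW
    rcases h with rfl | rfl
    · refine ⟨_, ⟨W', hW', Or.inl rfl⟩, ?_⟩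
      rcases h' with rfl | rfl
      exacts [Or.inr (key _ _), Or.inl (key' _ _)]
    · refine ⟨_, ⟨W', hW', Or.inr rfl⟩, ?_⟩
      rcases h' with rfl | rfl
      exacts [Or.inr (key _ _), Or.inl (key' _ _)]

theorem mapChain_neg {α : Type*} (φ₁ φ₂ : ℝ → α → α) (L : List (Bool × ℝ)) (x : α) :
    mapChain (fun t => φ₁ (-t)) (fun t => φ₂ (-t)) L x =
      mapChain φ₁ φ₂ (L.map fun p => (p.1, -p.2)) x := by
  induction L generalizing x with
  | nil => rfl
  | cons p L ih => simp [mapChain, ih]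

theorem mapReach_neg_subset {α : Type*} (φ₁ φ₂ : ℝ → α → α) (x : α) :
    mapReach (fun t => φ₁ (-t)) (fun t => φ₂ (-t)) (fun t => 0 < t) x ⊆
      mapReach φ₁ φ₂ (fun t => t < 0) x := by
  rintro _ ⟨L, hne, hL, rfl⟩
  refine ⟨L.map fun p => (p.1, -p.2), by simpa using hne, ?_, mapChain_neg φ₁ φ₂ L x⟩
  intro p hp
  obtain ⟨q, hq, rfl⟩ := List.mem_map.1 hp
  exact neg_neg_of_pos (hL q hq)

/-- `T` is the range of the strict derivative, at a parameter sent to `y`, of a map from a Banach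
space whose values near that parameter lie in `R`. -/
def IsTangentImage (R : Set E) (y : E) (T : Submodule ℝ E) : Prop :=
  ∃ (F : Type) (_ : NormedAddCommGroup F) (_ : NormedSpace ℝ F) (_ : CompleteSpace F)
    (f : F → E) (f' : F →L[ℝ] E) (u : F), HasStrictFDerivAt f f' u ∧ f u = y ∧
      (∀ᶠ v in 𝓝 u, f v ∈ R) ∧ f'.range = T

theorem IsTangentImage.mem_interior [CompleteSpace E] {R : Set E} {y : E}
    (h : IsTangentImage R y ⊤) : y ∈ interior R := by
  obtain ⟨F, _, _, _, f, f', u, hf, rfl, hR, hT⟩ := h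
  rw [mem_interior_iff_mem_nhds, ← hf.map_nhds_eq_of_surj hT]
  exact hR

/-- Flowing a tangent image by a flow that preserves `R` in positive time. -/
theorem IsTangentImage.flow {R : Set E} {y : E} {T : Submodule ℝ E} (h : IsTangentImage R y T)
    {φ : ℝ → E → E} (hR : ∀ x ∈ R, ∀ t, 0 < t → φ t x ∈ R) {t : ℝ} (ht : 0 < t)
    {A : E →L[ℝ] E} {w : E}
    (hφ : HasStrictFDerivAt (fun p : ℝ × E => φ p.1 p.2)
      (A ∘L ContinuousLinearMap.snd ℝ ℝ E + (ContinuousLinearMap.fst ℝ ℝ E).smulRight w) (t, y)) :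
    ∃ T', T.map (A : E →ₗ[ℝ] E) ≤ T' ∧ w ∈ T' ∧ IsTangentImage R (φ t y) T' := by
  obtain ⟨F, _, _, _, f, f', u, hf, rfl, hfR, rfl⟩ := h
  have hg : HasStrictFDerivAt (fun p : ℝ × F => (p.1, f p.2))
      ((ContinuousLinearMap.fst ℝ ℝ F).prod (f' ∘L ContinuousLinearMap.snd ℝ ℝ F)) (t, u) :=
    hasStrictFDerivAt_fst.prodMk (HasStrictFDerivAt.comp (t, u) hf hasStrictFDerivAt_snd)
  have hcomp := HasStrictFDerivAt.comp (t, u) (g := fun p : ℝ × E => φ p.1 p.2) hφ hg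
  refine ⟨_, ?_, ?_, ℝ × F, inferInstance, inferInstance, inferInstance,
    _, _, (t, u), hcomp, rfl, ?_, rfl⟩
  · rintro _ ⟨_, ⟨v, rfl⟩, rfl⟩
    exact ⟨(0, v), by simp⟩
  · exact ⟨(1, 0), by simp⟩
  · have h1 : ∀ᶠ p : ℝ × F in 𝓝 (t, u), 0 < p.1 :=
      continuousAt_fst.eventually (lt_mem_nhds ht)
    have h2 : ∀ᶠ p : ℝ × F in 𝓝 (t, u), f p.2 ∈ R := (continuous_snd.tendsto (t, u)).eventually hfR
    filter_upwards [h1, h2] with p hp1 hp2 using hR _ hp2 _ hp1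

/-- A tangent image of maximal dimension among those based in `N`. -/
def IsMaxTangentImage (R N : Set E) (y : E) (T : Submodule ℝ E) : Prop :=
  IsTangentImage R y T ∧ y ∈ N ∧ ∀ y' ∈ N, ∀ T', IsTangentImage R y' T' →
    Module.finrank ℝ T' ≤ Module.finrank ℝ T

theorem exists_isMaxTangentImage [FiniteDimensional ℝ E] {R N : Set E} {y : E}
    {T : Submodule ℝ E} (h : IsTangentImage R y T) (hy : y ∈ N) :
    ∃ y T, IsMaxTangentImage R N y T := by
  classical
  let S : Set ℕ := {d | ∃ y ∈ N, ∃ T, IsTangentImage R y T ∧ Module.finrank ℝ T = d}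
  have hne : S.Nonempty := ⟨_, y, hy, T, h, rfl⟩
  have hbdd : BddAbove S :=
    ⟨Module.finrank ℝ E, by rintro _ ⟨y, -, T, -, rfl⟩; exact T.finrank_le⟩
  obtain ⟨y, hy, T, hT, hd⟩ := Nat.sSup_mem hne hbdd
  exact ⟨y, T, hT, hy, fun y' hy' T' hT' => hd ▸ le_csSup hbdd ⟨y', hy', T', hT', rfl⟩⟩

variable [FiniteDimensional ℝ E] {X : E → E} {φ : ℝ → E → E} {R N : Set E}

/-- The flow transports a maximal tangent image isomorphically for short positive times. -/
theorem IsMaxTangentImage.eventually_flow {y : E} {T : Submodule ℝ E}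
    (hT : IsMaxTangentImage R N y T) (hN : IsOpen N) (hφ : IsGlobalFlow X φ)
    (hR : ∀ x ∈ R, ∀ t, 0 < t → φ t x ∈ R) {A : ℝ → E →L[ℝ] E}
    (hA : ∀ᶠ t in 𝓝[>] 0, HasStrictFDerivAt (fun p : ℝ × E => φ p.1 p.2)
        (A t ∘L ContinuousLinearMap.snd ℝ ℝ E +
          (ContinuousLinearMap.fst ℝ ℝ E).smulRight (X (φ t y))) (t, y))
    (hunit : ∀ᶠ t in 𝓝[>] 0, IsUnit (A t)) :
    ∀ᶠ t in 𝓝[>] 0, X (φ t y) ∈ T.map (A t : E →ₗ[ℝ] E) ∧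
      IsMaxTangentImage R N (φ t y) (T.map (A t : E →ₗ[ℝ] E)) := by
  have hNev : ∀ᶠ t in 𝓝[>] (0 : ℝ), φ t y ∈ N := by
    refine ((hφ.continuous_time y).tendsto' 0 y (hφ.map_zero y)).mono_left
      nhdsWithin_le_nhds |>.eventually (hN.mem_nhds hT.2.1)
  filter_upwards [hA, hunit, hNev, self_mem_nhdsWithin] with t hAt hu hNt ht
  obtain ⟨T', hle, hw, hT'⟩ := hT.1.flow hR ht hAt
  have hinj : Function.Injective (A t : E →ₗ[ℝ] E) := by
    obtain ⟨u, hu⟩ := hu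
    refine Function.LeftInverse.injective (g := (↑u⁻¹ : E →L[ℝ] E)) fun x => ?_
    have : ((↑u⁻¹ : E →L[ℝ] E) * ↑u) x = x := by rw [Units.inv_mul]; rfl
    rwa [hu] at this
  have hfin : Module.finrank ℝ (T.map (A t : E →ₗ[ℝ] E)) = Module.finrank ℝ T :=
    (Submodule.equivMapOfInjective _ hinj T).finrank_eq.symm
  have heq : T.map (A t : E →ₗ[ℝ] E) = T' :=
    Submodule.eq_of_le_of_finrank_le hle (hfin ▸ hT.2.2 _ hNt _ hT')
  rw [heq] at hfin ⊢
  exact ⟨hw, hT', hNt, fun y' hy' T'' hT'' => hfin ▸ hT.2.2 _ hy' _ hT''⟩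

/-- Pulling a vector field back along a family of invertible maps starting at the identity. -/
theorem hasDerivWithinAt_ringInverse_apply {A : ℝ → E →L[ℝ] E} {A' : E →L[ℝ] E} {c : ℝ → E}
    {c' : E} {s : Set ℝ} {t : ℝ} (hA0 : A t = ContinuousLinearMap.id ℝ E)
    (hA : HasDerivWithinAt A A' s t) (hc : HasDerivWithinAt c c' s t) :
    HasDerivWithinAt (fun t => Ring.inverse (A t) (c t)) (c' - A' (c t)) s t := by
  have := FiniteDimensional.complete ℝ E
  have h1 := hasFDerivAt_ringInverse (𝕜 := ℝ) (1 : (E →L[ℝ] E)ˣ)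
  have hA0' : A t = ((1 : (E →L[ℝ] E)ˣ) : E →L[ℝ] E) := hA0
  rw [← hA0'] at h1
  have h2 := (h1.comp_hasDerivWithinAt t hA).clm_apply hc
  refine h2.congr_deriv ?_
  have h3 : Ring.inverse (A t) = ContinuousLinearMap.id ℝ E := by
    rw [hA0]
    exact Ring.inverse_one _
  simp only [Function.comp_apply, h3]
  simp [sub_eq_neg_add]

theorem mem_of_hasDerivWithinAt_Ioi {T : Submodule ℝ E} {c : ℝ → E} {c' : E} (h0 : c 0 ∈ T)
    (hc : HasDerivWithinAt c c' (Ioi 0) 0) (hmem : ∀ᶠ t in 𝓝[>] 0, c t ∈ T) : c' ∈ T := by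
  have hlim := (hasDerivWithinAt_iff_tendsto_slope' self_notMem_Ioi).1 hc
  refine T.closed_of_finiteDimensional.mem_of_tendsto hlim ?_
  filter_upwards [hmem] with t ht
  rw [slope_def_module]
  exact T.smul_mem _ (T.sub_mem ht h0)

/-- A vector field generating a flow that preserves `R` is tangent to all maximal tangent images,
and the same holds for its brackets with fields tangent to all maximal tangent images. -/
theorem IsMaxTangentImage.mem (hN : IsOpen N) (hφ : IsGlobalFlow X φ) (hX : ContDiff ℝ 1 X)
    (hR : ∀ x ∈ R, ∀ t, 0 < t → φ t x ∈ R) {y : E} {T : Submodule ℝ E}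
    (hT : IsMaxTangentImage R N y T) :
    X y ∈ T ∧ ∀ V : E → E, Differentiable ℝ V →
      (∀ y T, IsMaxTangentImage R N y T → V y ∈ T) → VectorField.lieBracket ℝ X V y ∈ T := by
  have := FiniteDimensional.complete ℝ E
  obtain ⟨A, hA0, hA', hA⟩ := hφ.exists_hasStrictFDerivAt hX y
  have hunit : ∀ᶠ t in 𝓝[>] 0, IsUnit (A t) := by
    have h1 : Tendsto A (𝓝[>] 0) (𝓝 (A 0)) := hA'.continuousWithinAt
    rw [hA0] at h1
    exact h1.eventually (Units.isOpen.mem_nhds isUnit_one)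
  have hev := hT.eventually_flow hN hφ hR hA hunit
  have hinv : ∀ W : E → E, (∀ᶠ t in 𝓝[>] 0, W (φ t y) ∈ T.map (A t : E →ₗ[ℝ] E)) →
      ∀ᶠ t in 𝓝[>] 0, Ring.inverse (A t) (W (φ t y)) ∈ T := by
    intro W hW
    filter_upwards [hW, hunit] with t ht hu
    obtain ⟨w, hw, hwe⟩ := ht
    have h1 : (Ring.inverse (A t) * A t) w = w := by rw [Ring.inverse_mul_cancel _ hu]; rfl
    rw [← hwe]
    exact h1.symm ▸ hw
  have hderiv : ∀ W : E → E, Differentiable ℝ W →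
      HasDerivWithinAt (fun t => Ring.inverse (A t) (W (φ t y)))
        (VectorField.lieBracket ℝ X W y) (Ioi 0) 0 := by
    intro W hW
    have h1 : HasDerivWithinAt (fun t => W (φ t y)) (fderiv ℝ W (φ 0 y) (X (φ 0 y))) (Ioi 0) 0 :=
      ((hW (φ 0 y)).hasFDerivAt.comp_hasDerivAt 0 (hφ.hasDerivAt 0 y)).hasDerivWithinAt
    simpa only [hφ.map_zero, VectorField.lieBracket] using
      hasDerivWithinAt_ringInverse_apply hA0 hA' h1
  have hzero : ∀ W : E → E, Ring.inverse (A 0) (W (φ 0 y)) = W y := by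
    intro W
    have h1 : Ring.inverse (A 0) = ContinuousLinearMap.id ℝ E := by
      rw [hA0]
      exact Ring.inverse_one _
    rw [h1, hφ.map_zero]
    rfl
  refine ⟨?_, fun V hV hVT => ?_⟩
  · have hlim := (hderiv X (hX.differentiable one_ne_zero)).continuousWithinAt.tendsto
    rw [hzero X] at hlim
    exact T.closed_of_finiteDimensional.mem_of_tendsto hlim (hinv X (hev.mono fun t ht => ht.1))
  · exact mem_of_hasDerivWithinAt_Ioi (by rw [hzero V]; exact hVT _ _ hT) (hderiv V hV)
      (hinv V (hev.mono fun t ht => hVT _ _ ht.2))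

/-- The set of points where a family of continuous vector fields spans is a neighbourhood of
each of its points. -/
theorem eventually_span_eq_top {𝒱 : Set (E → E)} (h𝒱 : ∀ V ∈ 𝒱, Continuous V) {z : E}
    (hz : Submodule.span ℝ {v | ∃ V ∈ 𝒱, v = V z} = ⊤) :
    ∀ᶠ y in 𝓝 z, Submodule.span ℝ {v | ∃ V ∈ 𝒱, v = V y} = ⊤ := by
  obtain ⟨f, hf, -, hli⟩ := Submodule.exists_fun_fin_finrank_span_eq ℝ {v | ∃ V ∈ 𝒱, v = V z}
  choose V hV hVz using hf
  have hcont : Continuous fun y i => V i y := continuous_pi fun i => h𝒱 _ (hV i)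
  have hopen : ∀ᶠ y in 𝓝 z, LinearIndependent ℝ fun i => V i y := by
    refine hcont.continuousAt.eventually (isOpen_setOfPred_linearIndependent.mem_nhds ?_)
    have : (fun i => V i z) = f := funext fun i => (hVz i).symm
    simpa only [this, mem_ofPred_eq] using hli
  filter_upwards [hopen] with y hy
  have hcard : Fintype.card (Fin (Module.finrank ℝ (Submodule.span ℝ {v | ∃ V ∈ 𝒱, v = V z}))) =
      Module.finrank ℝ E := by
    rw [Fintype.card_fin, hz, finrank_top]
  rw [eq_top_iff, ← hy.span_eq_top_of_card_eq_finrank' hcard]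
  refine Submodule.span_mono ?_
  rintro _ ⟨i, rfl⟩
  exact ⟨V i, hV i, rfl⟩

/-- The positive reachable set accumulates at its base point with interior when the iterated
brackets span there. -/
theorem mem_closure_interior_mapReach_pos {k : ℕ} (hk : 1 ≤ k) {X₁ X₂ : E → E}
    (hX₁ : ContDiff ℝ k X₁) (hX₂ : ContDiff ℝ k X₂) {φ₁ φ₂ : ℝ → E → E}
    (hφ₁ : IsGlobalFlow X₁ φ₁) (hφ₂ : IsGlobalFlow X₂ φ₂) {z : E}
    (hLie : Submodule.span ℝ {v | ∃ m < k, ∃ V ∈ iterBrackets X₁ X₂ m, v = V z} = ⊤) :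
    z ∈ closure (interior (mapReach φ₁ φ₂ (fun t => 0 < t) z)) := by
  have hcomplete := FiniteDimensional.complete ℝ E
  have hk1 : ((1 : ℕ) : WithTop ℕ∞) ≤ k := by exact_mod_cast hk
  let 𝒱 : Set (E → E) := {V | ∃ m < k, V ∈ iterBrackets X₁ X₂ m}
  have h𝒱 : ∀ y, {v | ∃ V ∈ 𝒱, v = V y} =
      {v | ∃ m < k, ∃ V ∈ iterBrackets X₁ X₂ m, v = V y} := by
    intro y
    ext v
    exact ⟨fun ⟨V, ⟨m, hm, hV⟩, hv⟩ => ⟨m, hm, V, hV, hv⟩,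
      fun ⟨m, hm, V, hV, hv⟩ => ⟨V, ⟨m, hm, hV⟩, hv⟩⟩
  have hspan := eventually_span_eq_top (𝒱 := 𝒱)
    (fun V ⟨m, hm, hV⟩ => (contDiff_of_mem_iterBrackets hX₁ hX₂ (j := 0) (by omega) hV).continuous)
    (h𝒱 z ▸ hLie)
  obtain ⟨N₀, hN₀, hN₀_open, hzN₀⟩ := _root_.eventually_nhds_iff.1 hspan
  refine mem_closure_iff.2 fun W hW hzW => ?_
  set R := mapReach φ₁ φ₂ (fun t => 0 < t) z with hR_def
  have hN : IsOpen (W ∩ N₀) := hW.inter hN₀_open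
  have hR₁ : ∀ x ∈ R, ∀ t, 0 < t → φ₁ t x ∈ R := fun x hx t ht => mapReach_append hx true ht
  have hR₂ : ∀ x ∈ R, ∀ t, 0 < t → φ₂ t x ∈ R := fun x hx t ht => mapReach_append hx false ht
  have hNev : ∀ᶠ t in 𝓝[>] (0 : ℝ), φ₁ t z ∈ W ∩ N₀ := by
    refine ((hφ₁.continuous_time z).tendsto' 0 z (hφ₁.map_zero z)).mono_left
      nhdsWithin_le_nhds |>.eventually (hN.mem_nhds ⟨hzW, hzN₀⟩)
  obtain ⟨s, hsN, hs⟩ := (hNev.and self_mem_nhdsWithin).exists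
  have hstrict : HasStrictFDerivAt (fun t => φ₁ t z)
      (ContinuousLinearMap.toSpanSingleton ℝ (X₁ (φ₁ s z))) s :=
    hasStrictDerivAt_of_hasDerivAt_of_continuousAt
      (Eventually.of_forall fun t => hφ₁.hasDerivAt t z)
      (hX₁.continuous.comp (hφ₁.continuous_time z)).continuousAt
  have hbase : IsTangentImage R (φ₁ s z)
      (ContinuousLinearMap.toSpanSingleton ℝ (X₁ (φ₁ s z))).range := by
    refine ⟨ℝ, inferInstance, inferInstance, inferInstance, _, _, s, hstrict, rfl, ?_, rfl⟩
    filter_upwards [lt_mem_nhds hs] with t ht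
    exact ⟨[(true, t)], by simp, by simpa using ht, by simp [mapChain]⟩
  obtain ⟨y, T, hT⟩ := exists_isMaxTangentImage hbase hsN
  have htangent : ∀ m < k, ∀ V ∈ iterBrackets X₁ X₂ m, ∀ y T,
      IsMaxTangentImage R (W ∩ N₀) y T → V y ∈ T := by
    intro m
    induction m with
    | zero =>
      rintro - V (rfl | rfl) y T hT
      exacts [(hT.mem hN hφ₁ (hX₁.of_le hk1) hR₁).1, (hT.mem hN hφ₂ (hX₂.of_le hk1) hR₂).1]
    | succ m ih =>
      rintro hm _ ⟨V, hV, hVW⟩ y T hT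
      have hVd : Differentiable ℝ V :=
        (contDiff_of_mem_iterBrackets hX₁ hX₂ (j := 1) (by omega) hV).differentiable (by simp)
      rcases hVW with rfl | rfl
      exacts [(hT.mem hN hφ₁ (hX₁.of_le hk1) hR₁).2 V hVd (ih (by omega) V hV),
        (hT.mem hN hφ₂ (hX₂.of_le hk1) hR₂).2 V hVd (ih (by omega) V hV)]
  have hTtop : T = ⊤ := by
    rw [eq_top_iff, ← hN₀ y hT.2.1.2, Submodule.span_le]
    rintro _ ⟨V, ⟨m, hm, hV⟩, rfl⟩
    exact htangent m hm V hV y T hT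
  exact ⟨y, hT.2.1.1, (hTtop ▸ hT.1).mem_interior⟩

/-- The negative reachable set accumulates at its base point with interior when the iterated
brackets span there. -/
theorem mem_closure_interior_mapReach_neg {k : ℕ} (hk : 1 ≤ k) {X₁ X₂ : E → E}
    (hX₁ : ContDiff ℝ k X₁) (hX₂ : ContDiff ℝ k X₂) {φ₁ φ₂ : ℝ → E → E}
    (hφ₁ : IsGlobalFlow X₁ φ₁) (hφ₂ : IsGlobalFlow X₂ φ₂) {z : E}
    (hLie : Submodule.span ℝ {v | ∃ m < k, ∃ V ∈ iterBrackets X₁ X₂ m, v = V z} = ⊤) :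
    z ∈ closure (interior (mapReach φ₁ φ₂ (fun t => t < 0) z)) := by
  refine closure_mono (interior_mono (mapReach_neg_subset φ₁ φ₂ z))
    (mem_closure_interior_mapReach_pos hk hX₁.neg hX₂.neg hφ₁.neg hφ₂.neg ?_)
  rw [eq_top_iff, ← hLie, Submodule.span_le]
  rintro _ ⟨m, hm, V, hV, rfl⟩
  obtain ⟨V', hV', h⟩ := exists_mem_iterBrackets_neg hV
  have hmem : V' z ∈ Submodule.span ℝ {v | ∃ m < k,
      ∃ V ∈ iterBrackets (fun x => -X₁ x) (fun x => -X₂ x) m, v = V z} :=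
    Submodule.subset_span ⟨m, hm, V', hV', rfl⟩
  rcases h with rfl | rfl
  exacts [hmem, by simpa using Submodule.neg_mem _ hmem]

end Reach

end

/-- Krener's theorem (time-oriented case) on ℝⁿ: if the iterated Lie brackets of order
≤ k−1 of `X₁, X₂` span ℝⁿ at `z`, then `z` lies in the closure of the interior of its
positive reachable set and in the closure of the interior of its negative reachable set. -/
theorem mem_closure_interior_reach_of_lie_span
    (n k : ℕ) (hn : 1 ≤ n) (hk : 1 ≤ k)
    (X₁ X₂ : EuclideanSpace ℝ (Fin n) → EuclideanSpace ℝ (Fin n))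
    (hX₁ : ContDiff ℝ k X₁) (hX₂ : ContDiff ℝ k X₂)
    (φ₁ φ₂ : ℝ → EuclideanSpace ℝ (Fin n) → EuclideanSpace ℝ (Fin n))
    (hφ₁0 : ∀ x, φ₁ 0 x = x) (hφ₂0 : ∀ x, φ₂ 0 x = x)
    (hφ₁ : ∀ (t : ℝ) (x : EuclideanSpace ℝ (Fin n)),
      HasDerivAt (fun s => φ₁ s x) (X₁ (φ₁ t x)) t)
    (hφ₂ : ∀ (t : ℝ) (x : EuclideanSpace ℝ (Fin n)),
      HasDerivAt (fun s => φ₂ s x) (X₂ (φ₂ t x)) t)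
    (z : EuclideanSpace ℝ (Fin n))
    (hLie : Submodule.span ℝ
      {v : EuclideanSpace ℝ (Fin n) |
        ∃ m < k, ∃ V ∈ iterBrackets X₁ X₂ m, v = V z} = ⊤) :
    z ∈ closure (interior (mapReach φ₁ φ₂ (fun t => 0 < t) z)) ∩
      closure (interior (mapReach φ₁ φ₂ (fun t => t < 0) z)) := by
  exact ⟨mem_closure_interior_mapReach_pos hk hX₁ hX₂ ⟨hφ₁0, hφ₁⟩ ⟨hφ₂0, hφ₂⟩ hLie,
    mem_closure_interior_mapReach_neg hk hX₁ hX₂ ⟨hφ₁0, hφ₁⟩ ⟨hφ₂0, hφ₂⟩ hLie⟩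
end
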